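/- Let E be a complex vector space and let a and b be nonnegative sesquilinear forms on E. Then there exists a nonnegative sesquilinear form a_r on E such that: (1) for every y ∈ E, a_r(y, y) = lim_{n→∞} (a : n·b)(y, y), where (a : n·b)(y, y) = inf{ a(y + x, y + x) + n·b(x, x) : x ∈ E }; (2) a − a_r is a nonnegative sesquilinear form; (3) a_r is b-absolutely continuous, i.e. for every sequence (x_n) in E with b(x_n, x_n) → 0 and a_r(x_n − x_m, x_n − x_m) → 0 as n, m → ∞, one has a_r(x_n, x_n) → 0; and (4) a − a_r and b are mutually singular, i.e. the only nonnegative sesquilinear form c on E with c(y,y) ≤ (a − a_r)(y,y) and c(y,y) ≤ b(y,y) for all y is c = 0. Thus a = a_r + (a − a_r) is a Lebesgue-type decomposition of a with respect to b. -/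

import Mathlib

open Complex Filter Topology
open scoped ComplexOrder

/-- A nonnegative form is the pull-back of the inner product of a Hilbert space. -/
theorem form_repr.{u} {E : Type u} [AddCommGroup E] [Module ℂ E]
    (a : E →ₗ[ℂ] E →ₗ⋆[ℂ] ℂ) (ha : ∀ x, 0 ≤ a x x) :
    ∃ (H : Type u) (_ : NormedAddCommGroup H) (_ : InnerProductSpace ℂ H) (_ : CompleteSpace H)
      (J : E →ₗ[ℂ] H), ∀ x y, a x y = inner ℂ (J y) (J x) := by
  have hsymm : ∀ x y, (starRingEnd ℂ) (a x y) = a y x := by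
    intro x y
    have him : ∀ z, (a z z).im = 0 := fun z => ((Complex.nonneg_iff.1 (ha z)).2).symm
    have h1 := him (x + y)
    have h2 := him (x + Complex.I • y)
    simp [him] at h1 h2
    apply Complex.ext <;> simp <;> linarith
  let c : PreInnerProductSpace.Core ℂ E :=
    { inner := fun x y => a y x
      conj_inner_symm := fun x y => hsymm x y
      re_inner_nonneg := fun x => (Complex.nonneg_iff.1 (ha x)).1
      add_left := fun x y z => by simp
      smul_left := fun x y r => by simp }
  let i1 : SeminormedAddCommGroup E :=
    @InnerProductSpace.Core.toSeminormedAddCommGroup ℂ E _ _ _ c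
  let i2 : InnerProductSpace ℂ E := InnerProductSpace.ofCore c
  refine ⟨UniformSpace.Completion E, inferInstance, inferInstance, inferInstance,
    (UniformSpace.Completion.toComplL (𝕜 := ℂ) (E := E)).toLinearMap, ?_⟩
  intro x y
  have : inner ℂ (y : UniformSpace.Completion E) (x : UniformSpace.Completion E)
    = inner ℂ y x := UniformSpace.Completion.inner_coe y x
  exact this.symm

section hilbert

variable {E H K : Type*} [AddCommGroup E] [Module ℂ E]
  [NormedAddCommGroup H] [InnerProductSpace ℂ H]
  [NormedAddCommGroup K] [InnerProductSpace ℂ K]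

/-- The multivalued part of the closed relation generated by `(T x, J x)`. -/
def mulPart (J : E →ₗ[ℂ] H) (T : E →ₗ[ℂ] K) : Submodule ℂ H :=
  (LinearMap.range (J.prod T)).topologicalClosure.comap (LinearMap.inl ℂ H K)

theorem mem_mulPart (J : E →ₗ[ℂ] H) (T : E →ₗ[ℂ] K) (h : H) :
    h ∈ mulPart J T ↔ ∀ ε > 0, ∃ x, ‖h - J x‖ < ε ∧ ‖T x‖ < ε := by
  unfold mulPart
  rw [Submodule.mem_comap, ← SetLike.mem_coe, Submodule.topologicalClosure_coe,
    Metric.mem_closure_iff]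
  constructor
  · intro hh ε hε
    obtain ⟨_, ⟨x, rfl⟩, hx⟩ := hh ε hε
    refine ⟨x, ?_⟩
    simpa [Prod.dist_eq, dist_eq_norm] using hx
  · intro hh ε hε
    obtain ⟨x, hx⟩ := hh ε hε
    refine ⟨_, ⟨x, rfl⟩, ?_⟩
    simpa [Prod.dist_eq, dist_eq_norm] using hx

theorem isClosed_mulPart (J : E →ₗ[ℂ] H) (T : E →ₗ[ℂ] K) :
    IsClosed (mulPart J T : Set H) := by
  unfold mulPart
  have : Continuous (LinearMap.inl ℂ H K) := by
    exact (ContinuousLinearMap.inl ℂ H K).continuous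
  exact (Submodule.isClosed_topologicalClosure _).preimage this

theorem mulPart_of_tendsto (J : E →ₗ[ℂ] H) (T : E →ₗ[ℂ] K) (x : ℕ → E) (h : H)
    (h1 : Tendsto (fun n => J (x n)) atTop (𝓝 h))
    (h2 : Tendsto (fun n => T (x n)) atTop (𝓝 0)) : h ∈ mulPart J T := by
  rw [mem_mulPart]
  intro ε hε
  have e1 := (Metric.tendsto_nhds.1 h1) ε hε
  have e2 := (Metric.tendsto_nhds.1 h2) ε hε
  obtain ⟨n, hn1, hn2⟩ := (e1.and e2).exists
  refine ⟨x n, ?_, ?_⟩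
  · rwa [dist_comm, dist_eq_norm] at hn1
  · simpa using hn2

theorem tendsto_parallel [CompleteSpace H] (J : E →ₗ[ℂ] H) (T : E →ₗ[ℂ] K) (y : E)
    (Q : H →L[ℂ] H) (hQ1 : ∀ u, ‖Q u‖ ≤ ‖u‖) (hQ2 : ∀ u ∈ mulPart J T, Q u = 0)
    (hQ3 : ∀ u, u - Q u ∈ mulPart J T) :
    Tendsto (fun n : ℕ => sInf {r : ℝ | ∃ x : E, r = ‖J (y + x)‖ ^ 2 + (n : ℝ) * ‖T x‖ ^ 2})
      atTop (𝓝 (‖Q (J y)‖ ^ 2)) := by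
  set S : ℕ → Set ℝ := fun n => {r : ℝ | ∃ x : E, r = ‖J (y + x)‖ ^ 2 + (n : ℝ) * ‖T x‖ ^ 2}
    with hS
  set f : ℕ → ℝ := fun n => sInf (S n) with hf
  have hbdd : ∀ n, BddBelow (S n) := by
    intro n
    refine ⟨0, ?_⟩
    rintro r ⟨x, rfl⟩
    positivity
  have hne : ∀ n, (S n).Nonempty := fun n => ⟨_, 0, rfl⟩
  have hle : ∀ n x, f n ≤ ‖J (y + x)‖ ^ 2 + (n : ℝ) * ‖T x‖ ^ 2 :=
    fun n x => csInf_le (hbdd n) ⟨x, rfl⟩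
  have hmono : Monotone f := by
    intro n m hnm
    refine le_csInf (hne m) ?_
    rintro r ⟨x, rfl⟩
    refine (hle n x).trans ?_
    have : (n : ℝ) ≤ m := by exact_mod_cast hnm
    gcongr
  have hup : ∀ n, f n ≤ ‖Q (J y)‖ ^ 2 := by
    intro n
    have hlim : Tendsto (fun ε : ℝ => (‖Q (J y)‖ + ε) ^ 2 + (n : ℝ) * ε ^ 2) (𝓝[>] 0)
        (𝓝 ((‖Q (J y)‖ + 0) ^ 2 + (n : ℝ) * 0 ^ 2)) := by
      apply Tendsto.mono_left _ nhdsWithin_le_nhds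
      apply Continuous.tendsto
      fun_prop
    have hlim2 : Tendsto (fun ε : ℝ => (‖Q (J y)‖ + ε) ^ 2 + (n : ℝ) * ε ^ 2) (𝓝[>] 0)
        (𝓝 (‖Q (J y)‖ ^ 2)) := by simpa using hlim
    refine ge_of_tendsto hlim2 ?_
    filter_upwards [self_mem_nhdsWithin] with ε hε
    obtain ⟨x, hx1, hx2⟩ := (mem_mulPart J T _).1 (hQ3 (J y)) ε hε
    refine (hle n (-x)).trans ?_
    have e : J (y + -x) = Q (J y) + (J y - Q (J y) - J x) := by
      rw [map_add, map_neg]; abel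
    have : ‖J (y + -x)‖ ≤ ‖Q (J y)‖ + ε := by
      rw [e]
      exact (norm_add_le _ _).trans (by linarith)
    rw [map_neg, norm_neg]
    gcongr
  have hbf : BddAbove (Set.range f) := ⟨_, by rintro _ ⟨n, rfl⟩; exact hup n⟩
  have hL := tendsto_atTop_ciSup hmono hbf
  set L := ⨆ n, f n
  have hfL : ∀ n, f n ≤ L := fun n => le_ciSup hbf n
  have hx : ∀ n : ℕ, ∃ x, ‖J (y + x)‖ ^ 2 + (n : ℝ) * ‖T x‖ ^ 2 < f n + 1 / ((n : ℝ) + 1) := by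
    intro n
    obtain ⟨r, ⟨x, rfl⟩, h⟩ := exists_lt_of_csInf_lt (hne n)
      (show sInf (S n) < f n + 1 / ((n : ℝ) + 1) from by
        have : (0 : ℝ) < 1 / ((n : ℝ) + 1) := by positivity
        simp only [hf]; linarith)
    exact ⟨x, h⟩
  choose x hx using hx
  have hone : Tendsto (fun n : ℕ => 1 / ((n : ℝ) + 1)) atTop (𝓝 0) :=
    tendsto_one_div_add_atTop_nhds_zero_nat
  have hpar : ∀ {V : Type _} [NormedAddCommGroup V] [InnerProductSpace ℂ V] (u v : V),
      ‖u - v‖ ^ 2 = 2 * ‖u‖ ^ 2 + 2 * ‖v‖ ^ 2 - 4 * ‖(2⁻¹ : ℂ) • (u + v)‖ ^ 2 := by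
    intro V _ _ u v
    have := parallelogram_law_with_norm ℂ u v
    rw [norm_smul]
    norm_num
    nlinarith
  have hpar' : ∀ (u v : K),
      ‖(2⁻¹ : ℂ) • (u + v)‖ ^ 2 ≤ 2⁻¹ * ‖u‖ ^ 2 + 2⁻¹ * ‖v‖ ^ 2 := by
    intro u v
    have := parallelogram_law_with_norm ℂ u v
    rw [norm_smul]
    norm_num
    nlinarith [sq_nonneg ‖u - v‖]
  have hdist : ∀ n m, n ≤ m → ‖J (x n) - J (x m)‖ ^ 2 ≤
      2 * (L - f n) + 4 * (1 / ((n : ℝ) + 1)) := by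
    intro n m hnm
    have hcast : (n : ℝ) ≤ m := by exact_mod_cast hnm
    have h1 := hx n
    have h2 := hx m
    have h3 : (n : ℝ) * ‖T (x m)‖ ^ 2 ≤ m * ‖T (x m)‖ ^ 2 := by gcongr
    have h4 : 1 / ((m : ℝ) + 1) ≤ 1 / ((n : ℝ) + 1) := by gcongr
    have h5 := hle n ((2⁻¹ : ℂ) • (x n + x m))
    have e1 : J (x n) - J (x m) = J (y + x n) - J (y + x m) := by simp
    have e2 : J (y + (2⁻¹ : ℂ) • (x n + x m)) = (2⁻¹ : ℂ) • (J (y + x n) + J (y + x m)) := by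
      rw [← map_add, ← map_smul]
      congr 1
      module
    have h6 : ‖J (x n) - J (x m)‖ ^ 2 = 2 * ‖J (y + x n)‖ ^ 2 + 2 * ‖J (y + x m)‖ ^ 2
        - 4 * ‖J (y + (2⁻¹ : ℂ) • (x n + x m))‖ ^ 2 := by
      rw [e1, e2]; exact hpar _ _
    have h7 : (n : ℝ) * ‖T ((2⁻¹ : ℂ) • (x n + x m))‖ ^ 2 ≤
        n * (2⁻¹ * ‖T (x n)‖ ^ 2 + 2⁻¹ * ‖T (x m)‖ ^ 2) := by
      rw [map_smul, map_add]
      have := hpar' (T (x n)) (T (x m))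
      gcongr
    have h8 := hfL m
    nlinarith
  have hcau : CauchySeq (fun n => J (x n)) := by
    refine cauchySeq_of_le_tendsto_0' (fun n : ℕ =>
      √(2 * (L - f n) + 4 * (1 / ((n : ℝ) + 1)))) ?_ ?_
    · intro n m hnm
      rw [dist_eq_norm]
      exact Real.le_sqrt_of_sq_le (hdist n m hnm)
    · have : Tendsto (fun n : ℕ => √(2 * (L - f n) + 4 * (1 / ((n : ℝ) + 1)))) atTop
          (𝓝 (√(2 * (L - L) + 4 * 0))) :=
        (((tendsto_const_nhds.sub hL).const_mul 2).add (hone.const_mul 4)).sqrt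
      simpa using this
  obtain ⟨h, hh⟩ := cauchySeq_tendsto_of_complete hcau
  have hT : Tendsto (fun n => T (x n)) atTop (𝓝 0) := by
    rw [tendsto_zero_iff_norm_tendsto_zero]
    have hb : ∀ n : ℕ, ‖T (x n)‖ ^ 2 ≤ (L + 2 + ‖T (x n)‖ ^ 2 * 0) * (1 / (n : ℝ)) ∨ n = 0 := by
      intro n
      rcases Nat.eq_zero_or_pos n with h0 | h0
      · exact Or.inr h0
      · left
        have hn : (0 : ℝ) < n := by exact_mod_cast h0
        rw [mul_one_div, le_div_iff₀ hn]
        have h1 := hx n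
        have h2 := hfL n
        have h3 : 1 / ((n : ℝ) + 1) ≤ 1 := by
          rw [div_le_one (by positivity)]; linarith
        nlinarith [sq_nonneg ‖J (y + x n)‖]
    have hz : Tendsto (fun n => ‖T (x n)‖ ^ 2) atTop (𝓝 0) := by
      have h0 : Tendsto (fun n : ℕ => (L + 2) * (1 / (n : ℝ))) atTop (𝓝 0) := by
        simpa using (tendsto_one_div_atTop_nhds_zero_nat (𝕜 := ℝ)).const_mul (L + 2)
      refine squeeze_zero' (Eventually.of_forall fun n => by positivity) ?_ h0
      filter_upwards [eventually_gt_atTop 0] with n hn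
      rcases hb n with h | h
      · simpa using h
      · omega
    have := hz.sqrt
    simpa using this
  have hM := mulPart_of_tendsto J T x h hh hT
  have hD : ‖Q (J y)‖ ^ 2 ≤ L := by
    have h1 : ‖Q (J y)‖ ≤ ‖J y + h‖ := by
      have := hQ1 (J y + h)
      rwa [map_add, hQ2 h hM, add_zero] at this
    have h2 : ‖J y + h‖ ^ 2 ≤ L + 0 := by
      refine le_of_tendsto_of_tendsto ((tendsto_const_nhds.add hh).norm.pow 2)
        (hL.add hone) (Eventually.of_forall fun n => ?_)
      have := hx n
      rw [map_add] at this
      have h3 : 0 ≤ (n : ℝ) * ‖T (x n)‖ ^ 2 := by positivity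
      show ‖J y + J (x n)‖ ^ 2 ≤ f n + 1 / ((n : ℝ) + 1)
      linarith
    calc ‖Q (J y)‖ ^ 2 ≤ ‖J y + h‖ ^ 2 := by gcongr
      _ ≤ L := by linarith
  have hLD : L = ‖Q (J y)‖ ^ 2 := le_antisymm (ciSup_le hup) hD
  rwa [hLD] at hL

end hilbert

/-- The pull-back of the inner product along a linear map. -/
noncomputable def pullForm {E H : Type*} [AddCommGroup E] [Module ℂ E]
    [NormedAddCommGroup H] [InnerProductSpace ℂ H] (R : E →ₗ[ℂ] H) :
    E →ₗ[ℂ] E →ₗ⋆[ℂ] ℂ :=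
  LinearMap.mk₂'ₛₗ (RingHom.id ℂ) (starRingEnd ℂ) (fun x y => inner ℂ (R y) (R x))
    (by intros; simp) (by intros; simp)
    (by intros; simp) (by intros; simp [mul_comm])

/-- **Theorem 2.8 (Lebesgue-type decomposition), form version.**  For nonnegative
sesquilinear forms `a, b` on `E` there is a nonnegative form `a_r` with
`a_r(y,y) = lim_n (a : n·b)(y,y)`, such that `a − a_r` is nonnegative, `a_r` is
`b`-absolutely continuous, and `a − a_r` and `b` are mutually singular. -/
theorem lebesgue_decomposition_form
    {E : Type*} [AddCommGroup E] [Module ℂ E]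
    (a b : E →ₗ[ℂ] E →ₗ⋆[ℂ] ℂ) (ha : ∀ x, 0 ≤ a x x) (hb : ∀ x, 0 ≤ b x x) :
    ∃ ar : E →ₗ[ℂ] E →ₗ⋆[ℂ] ℂ, (∀ y, 0 ≤ ar y y) ∧
      (∀ y : E, Tendsto (fun n : ℕ =>
          sInf {r : ℝ | ∃ x : E, r = (a (y + x) (y + x)).re + (n : ℝ) * (b x x).re})
        atTop (𝓝 ((ar y y).re))) ∧
      (∀ y, 0 ≤ (a - ar) y y) ∧
      (∀ x : ℕ → E,
        Tendsto (fun n => (b (x n) (x n)).re) atTop (𝓝 0) →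
        Tendsto (fun q : ℕ × ℕ =>
          (ar (x q.1 - x q.2) (x q.1 - x q.2)).re) atTop (𝓝 0) →
        Tendsto (fun n => (ar (x n) (x n)).re) atTop (𝓝 0)) ∧
      (∀ c : E →ₗ[ℂ] E →ₗ⋆[ℂ] ℂ, (∀ y, 0 ≤ c y y) →
        (∀ y, (c y y).re ≤ ((a - ar) y y).re) →
        (∀ y, (c y y).re ≤ (b y y).re) → c = 0) := by
  obtain ⟨H, _, _, _, J, hJ⟩ := form_repr a ha
  obtain ⟨K, _, _, _, T, hT⟩ := form_repr b hb
  have hcl := isClosed_mulPart J T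
  set M := mulPart J T with hMdef
  have : CompleteSpace M := hcl.completeSpace_coe
  set P : H →L[ℂ] H := M.starProjection with hP
  set Q : H →L[ℂ] H := Mᗮ.starProjection with hQ
  have hPM : ∀ u, P u ∈ M := fun u => Submodule.starProjection_apply_mem _ _
  have hQM : ∀ u, Q u ∈ Mᗮ := fun u => Submodule.starProjection_apply_mem _ _
  have hPQ : ∀ u, P u + Q u = u := fun u =>
    Submodule.starProjection_add_starProjection_orthogonal u
  have hP1 : ∀ u, ‖P u‖ ≤ ‖u‖ := fun u => Submodule.norm_starProjection_apply_le _ _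
  have hQ1 : ∀ u, ‖Q u‖ ≤ ‖u‖ := fun u => Submodule.norm_starProjection_apply_le _ _
  have hPid : ∀ u ∈ M, P u = u := fun u hu => Submodule.starProjection_eq_self_iff.2 hu
  have hQ2 : ∀ u ∈ M, Q u = 0 := by
    intro u hu
    have := hPQ u
    rw [hPid u hu] at this
    simpa using this
  have hQ3 : ∀ u, u - Q u ∈ M := by
    intro u
    have : u - Q u = P u := by rw [sub_eq_iff_eq_add, hPQ]
    rw [this]; exact hPM u
  have hpyth : ∀ u, ‖u‖ ^ 2 = ‖P u‖ ^ 2 + ‖Q u‖ ^ 2 := fun u =>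
    Submodule.norm_sq_eq_add_norm_sq_starProjection u M
  have ha' : ∀ x, a x x = ((‖J x‖ ^ 2 : ℝ) : ℂ) := fun x => by
    rw [hJ, inner_self_eq_norm_sq_to_K]; simp
  have hb' : ∀ x, b x x = ((‖T x‖ ^ 2 : ℝ) : ℂ) := fun x => by
    rw [hT, inner_self_eq_norm_sq_to_K]; simp
  set ar := pullForm (Q.toLinearMap ∘ₗ J) with har
  have har' : ∀ x, ar x x = ((‖Q (J x)‖ ^ 2 : ℝ) : ℂ) := fun x => by
    have : ar x x = inner ℂ (Q (J x)) (Q (J x)) := rfl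
    rw [this, inner_self_eq_norm_sq_to_K]; simp
  have hs' : ∀ x, (a - ar) x x = ((‖P (J x)‖ ^ 2 : ℝ) : ℂ) := fun x => by
    rw [LinearMap.sub_apply, LinearMap.sub_apply, ha', har', hpyth (J x)]
    push_cast; ring
  refine ⟨ar, ?_, ?_, ?_, ?_, ?_⟩
  · intro y
    rw [har', Complex.zero_le_real]; positivity
  · intro y
    simp only [ha', hb', har', Complex.ofReal_re]
    exact tendsto_parallel J T y Q hQ1 hQ2 hQ3
  · intro y
    rw [hs', Complex.zero_le_real]; positivity
  · intro x hx1 hx2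
    simp only [hb', har', Complex.ofReal_re] at hx1 hx2 ⊢
    have hTx : Tendsto (fun n => ‖T (x n)‖) atTop (𝓝 0) := by simpa using hx1.sqrt
    have hcau : CauchySeq (fun n => Q (J (x n))) := by
      rw [cauchySeq_iff_tendsto_dist_atTop_0]
      have := hx2.sqrt
      simpa [dist_eq_norm] using this
    obtain ⟨h, hh⟩ := cauchySeq_tendsto_of_complete hcau
    have hz : ∀ n : ℕ, ∃ z, ‖P (J (x n)) - J z‖ < 1 / ((n : ℝ) + 1) ∧
        ‖T z‖ < 1 / ((n : ℝ) + 1) := fun n =>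
      (mem_mulPart J T _).1 (hPM (J (x n))) _ (by positivity)
    choose z hz1 hz2 using hz
    have hone : Tendsto (fun n : ℕ => 1 / ((n : ℝ) + 1)) atTop (𝓝 0) :=
      tendsto_one_div_add_atTop_nhds_zero_nat
    have hM : h ∈ M := by
      refine mulPart_of_tendsto J T (fun n => x n - z n) h ?_ ?_
      · have h1 : Tendsto (fun n => P (J (x n)) - J (z n)) atTop (𝓝 0) :=
          squeeze_zero_norm (fun n => (hz1 n).le) hone
        have h2 := hh.add h1
        rw [add_zero] at h2
        refine h2.congr fun n => ?_
        rw [map_sub]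
        nth_rewrite 3 [← hPQ (J (x n))]
        abel
      · have h1 : Tendsto (fun n => T (z n)) atTop (𝓝 0) :=
          squeeze_zero_norm (fun n => (hz2 n).le) hone
        have h2 := (tendsto_zero_iff_norm_tendsto_zero.2 hTx).sub h1
        simpa using h2
    have hMo : h ∈ Mᗮ := (Submodule.isClosed_orthogonal M).mem_of_tendsto hh
      (Eventually.of_forall fun n => hQM _)
    have h0 : h = 0 := by
      have := Submodule.inner_right_of_mem_orthogonal hM hMo
      exact inner_self_eq_zero.1 this
    rw [h0] at hh
    simpa using hh.norm.pow 2
  · intro c hc hc1 hc2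
    obtain ⟨G, _, _, _, S, hS⟩ := form_repr c hc
    have hc' : ∀ x, c x x = ((‖S x‖ ^ 2 : ℝ) : ℂ) := fun x => by
      rw [hS, inner_self_eq_norm_sq_to_K]; simp
    have h1 : ∀ y, ‖S y‖ ≤ ‖P (J y)‖ := fun y => by
      have := hc1 y
      rw [hc', hs', Complex.ofReal_re, Complex.ofReal_re] at this
      exact (sq_le_sq₀ (norm_nonneg _) (norm_nonneg _)).1 this
    have h2 : ∀ y, ‖S y‖ ≤ ‖T y‖ := fun y => by
      have := hc2 y
      rw [hc', hb', Complex.ofReal_re, Complex.ofReal_re] at this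
      exact (sq_le_sq₀ (norm_nonneg _) (norm_nonneg _)).1 this
    have h3 : ∀ y, S y = 0 := by
      intro y
      rw [← norm_le_zero_iff]
      refine le_of_forall_pos_le_add fun ε hε => ?_
      obtain ⟨z, hz1, hz2⟩ := (mem_mulPart J T _).1 (hPM (J y)) (ε / 2) (by positivity)
      have e1 : S y = S (y - z) + S z := by rw [← map_add, sub_add_cancel]
      have e2 : P (J (y - z)) = P (P (J y) - J z) := by
        rw [map_sub, map_sub, map_sub, hPid _ (hPM _)]
      have e3 := h1 (y - z)
      rw [e2] at e3
      have e4 := hP1 (P (J y) - J z)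
      have e5 := h2 z
      have e6 := norm_add_le (S (y - z)) (S z)
      rw [← e1] at e6
      linarith
    ext x y
    rw [hS, h3 x]
    simp
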